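/- arXiv:0906.4873 — 2 statements merged into one kernel-verified Lean document; each statement's English description precedes it below -/
import Mathlib

section
/- Let k be an algebraically closed field of characteristic zero and let I ⊆ k[x₁,…,xₙ] be a cellular binomial ideal with cell indices E. Then every associated prime of I is a cellular binomial ideal with the same cell indices E; in fact every associated prime has the form M(E) + I₊(τ) for some saturated partial character (Sat(L'),τ) on ℤ^E. -/
open MvPolynomial

/-- A binomial is a polynomial with at most two terms. -/
def IsBinomial {k : Type*} [CommSemiring k] {n : ℕ} (f : MvPolynomial (Fin n) k) : Prop :=
  f.support.card ≤ 2

/-- A binomial ideal is an ideal generated by binomials. -/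
def IsBinomialIdeal {k : Type*} [CommSemiring k] {n : ℕ}
    (I : Ideal (MvPolynomial (Fin n) k)) : Prop :=
  ∃ S : Set (MvPolynomial (Fin n) k), (∀ f ∈ S, IsBinomial f) ∧ I = Ideal.span S

/-- A proper binomial ideal is cellular if each variable is either a nonzerodivisor or
nilpotent modulo the ideal. -/
def IsCellular {k : Type*} [CommSemiring k] {n : ℕ}
    (I : Ideal (MvPolynomial (Fin n) k)) : Prop :=
  I ≠ ⊤ ∧ ∀ i : Fin n,
    (∀ f, X i * f ∈ I → f ∈ I) ∨ ∃ m : ℕ, (X i : MvPolynomial (Fin n) k) ^ m ∈ I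

/-- `M(E)`, the ideal generated by the variables not in `E`. -/
noncomputable def MIdeal {k : Type*} [CommSemiring k] {n : ℕ} (E : Set (Fin n)) :
    Ideal (MvPolynomial (Fin n) k) :=
  Ideal.span {f | ∃ i ∉ E, f = X i}

/-- The monic monomial `x^a` with exponent vector `a`. -/
noncomputable def monomF {k : Type*} [CommSemiring k] {α : Type*} [Finite α]
    (a : α → ℕ) : MvPolynomial α k :=
  monomial (Finsupp.equivFunOnFinite.symm a) 1

/-- The lattice ideal `I₊(σ) = ⟨x^{m⁺} - σ(m)·x^{m⁻} : m ∈ L⟩` of a partial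
character `(L, σ)`. -/
noncomputable def latticeIdeal {k : Type*} [Field k] {α : Type*} [Finite α]
    (L : AddSubgroup (α → ℤ)) (σ : L → kˣ) : Ideal (MvPolynomial α k) :=
  Ideal.span {f | ∃ m : L, f =
    monomF (fun i => ((m : α → ℤ) i).toNat) -
      (σ m : k) • monomF (fun i => (-((m : α → ℤ) i)).toNat)}

open Classical in
/-- Projection of a polynomial onto the span of the monomials satisfying `T`. -/
noncomputable def monProj (k : Type*) [Field k] {σ : Type*} (T : (σ →₀ ℕ) → Prop) :
    MvPolynomial σ k →ₗ[k] MvPolynomial σ k :=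
  (basisMonomials σ k).constr k (fun m => if T m then monomial m 1 else 0)

open Classical in
theorem monProj_monomial {k : Type*} [Field k] {σ : Type*} (T : (σ →₀ ℕ) → Prop)
    (m : σ →₀ ℕ) (c : k) :
    monProj k T (monomial m c) = if T m then monomial m c else 0 := by
  have h : (monomial m c : MvPolynomial σ k) = c • (basisMonomials σ k m) := by
    simp [smul_monomial]
  rw [h, map_smul, monProj, Module.Basis.constr_basis]
  split_ifs <;> simp

open Classical in
theorem coeff_monProj {k : Type*} [Field k] {σ : Type*} (T : (σ →₀ ℕ) → Prop)
    (m : σ →₀ ℕ) (f : MvPolynomial σ k) :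
    coeff m (monProj k T f) = if T m then coeff m f else 0 := by
  induction f using MvPolynomial.induction_on' with
  | monomial u a =>
    rw [monProj_monomial]
    by_cases h : u = m
    · subst h; split_ifs <;> simp
    · split_ifs <;> simp [coeff_monomial, h]
  | add p q hp hq =>
    rw [map_add, coeff_add, hp, hq, coeff_add]
    split_ifs <;> simp

theorem monProj_monomial_mul {k : Type*} [Field k] {σ : Type*} (T T' : (σ →₀ ℕ) → Prop)
    (u : σ →₀ ℕ) (c : k) (h : ∀ b, T (u + b) ↔ T' b) (f : MvPolynomial σ k) :
    monProj k T (monomial u c * f) = monomial u c * monProj k T' f := by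
  classical
  induction f using MvPolynomial.induction_on' with
  | monomial v a =>
    rw [monomial_mul, monProj_monomial, monProj_monomial]
    simp only [h]
    split_ifs <;> simp [monomial_mul]
  | add p q hp hq =>
    rw [mul_add, map_add, hp, hq, map_add, mul_add]

theorem mem_of_monProj {k : Type*} [Field k] {σ D : Type*} (T : D → (σ →₀ ℕ) → Prop)
    (deg : (σ →₀ ℕ) → D) (f : MvPolynomial σ k)
    (h : ∀ b ∈ f.support, ∀ d, T d b ↔ deg b = d) (J : Ideal (MvPolynomial σ k))
    (hJ : ∀ b ∈ f.support, monProj k (T (deg b)) f ∈ J) : f ∈ J := by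
  classical
  have : f = ∑ d ∈ f.support.image deg, monProj k (T d) f := by
    ext b
    rw [coeff_sum]
    simp only [coeff_monProj]
    by_cases hb : b ∈ f.support
    · simp only [h b hb]
      rw [Finset.sum_ite_eq, if_pos (Finset.mem_image_of_mem _ hb)]
    · rw [notMem_support_iff.mp hb]; simp
  rw [this]
  refine Ideal.sum_mem _ fun d hd => ?_
  obtain ⟨b, hb, rfl⟩ := Finset.mem_image.mp hd
  exact hJ b hb

theorem monProj_eq_zero {k : Type*} [Field k] {σ : Type*} (T : (σ →₀ ℕ) → Prop)
    (f : MvPolynomial σ k) (h : ∀ b ∈ f.support, ¬ T b) : monProj k T f = 0 := by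
  classical
  ext b
  rw [coeff_monProj, coeff_zero]
  split_ifs with hb
  · by_contra hc
    exact h b (mem_support_iff.mpr hc) hb
  · rfl

/-- Two monomials are related when they agree up to a unit modulo `I`. -/
def MRel {k : Type*} [Field k] {σ : Type*} (I : Ideal (MvPolynomial σ k))
    (a b : σ →₀ ℕ) : Prop :=
  ∃ c : k, c ≠ 0 ∧ monomial a 1 - monomial b c ∈ I

theorem MRel.refl {k : Type*} [Field k] {σ : Type*} (I : Ideal (MvPolynomial σ k))
    (a : σ →₀ ℕ) : MRel I a a := ⟨1, one_ne_zero, by simp⟩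

theorem MRel.symm {k : Type*} [Field k] {σ : Type*} {I : Ideal (MvPolynomial σ k)}
    {a b : σ →₀ ℕ} (h : MRel I a b) : MRel I b a := by
  obtain ⟨c, hc, h⟩ := h
  refine ⟨c⁻¹, inv_ne_zero hc, ?_⟩
  have := I.mul_mem_left (C (-c⁻¹)) h
  rw [mul_sub, C_mul_monomial, C_mul_monomial] at this
  have e : -c⁻¹ * c = -1 := by field_simp
  rw [e] at this
  convert this using 1
  simp
  ring

theorem MRel.trans {k : Type*} [Field k] {σ : Type*} {I : Ideal (MvPolynomial σ k)}
    {a b d : σ →₀ ℕ} (h : MRel I a b) (h' : MRel I b d) : MRel I a d := by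
  obtain ⟨c, hc, h⟩ := h
  obtain ⟨c', hc', h'⟩ := h'
  refine ⟨c * c', mul_ne_zero hc hc', ?_⟩
  have := I.add_mem h (I.mul_mem_left (C c) h')
  rw [mul_sub, C_mul_monomial, C_mul_monomial] at this
  simpa using this

theorem MRel.add {k : Type*} [Field k] {σ : Type*} {I : Ideal (MvPolynomial σ k)}
    {a b : σ →₀ ℕ} (h : MRel I a b) (u : σ →₀ ℕ) : MRel I (a + u) (b + u) := by
  obtain ⟨c, hc, h⟩ := h
  refine ⟨c, hc, ?_⟩
  have := I.mul_mem_right (monomial u 1) h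
  rw [sub_mul, monomial_mul, monomial_mul] at this
  simpa using this

theorem monProj_binomial_mem {k : Type*} [Field k] {n : ℕ} {I : Ideal (MvPolynomial (Fin n) k)}
    (T : (Fin n →₀ ℕ) → Prop) (hT : ∀ a b, MRel I a b → (T a ↔ T b))
    (f : MvPolynomial (Fin n) k) (hf : IsBinomial f) (hI : f ∈ I) : monProj k T f ∈ I := by
  classical
  unfold IsBinomial at hf
  have key : ∀ a ∈ f.support, ∀ b ∈ f.support, MRel I a b := by
    intro a ha b hb
    by_cases hab : a = b
    · rw [hab]; exact MRel.refl _ _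
    have hs : f.support = {a, b} := by
      symm
      apply Finset.eq_of_subset_of_card_le
      · intro x hx
        simp at hx
        rcases hx with rfl | rfl <;> assumption
      · rw [Finset.card_pair hab]; exact hf
    have hfe : f = monomial a (coeff a f) + monomial b (coeff b f) := by
      conv_lhs => rw [f.as_sum, hs, Finset.sum_pair hab]
    have ha' := mem_support_iff.mp ha
    have hb' := mem_support_iff.mp hb
    refine ⟨-((coeff a f)⁻¹ * coeff b f), by simp [ha', hb'], ?_⟩
    have := I.mul_mem_left (C (coeff a f)⁻¹) hI
    rw [hfe, mul_add, C_mul_monomial, C_mul_monomial, ← hfe, inv_mul_cancel₀ ha'] at this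
    convert this using 1
    rw [map_neg, sub_neg_eq_add]
  refine mem_of_monProj (D := Unit) (fun _ _ => True) (fun _ => ()) _ (by simp) I ?_ |> fun h => h
  intro _ _
  by_cases h : ∃ a ∈ f.support, T a
  · obtain ⟨a, ha, hTa⟩ := h
    convert hI using 1
    ext b
    rw [coeff_monProj, if_pos trivial, coeff_monProj]
    split_ifs with hb
    · rfl
    · symm
      by_contra hc
      exact hb ((hT a b (key a ha b (mem_support_iff.mpr hc))).mp hTa)
  · push Not at h
    rw [monProj_eq_zero T f h]; simp

theorem monProj_mem {k : Type*} [Field k] {n : ℕ} {I : Ideal (MvPolynomial (Fin n) k)}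
    (hbin : IsBinomialIdeal I)
    (T : (Fin n →₀ ℕ) → Prop) (hT : ∀ a b, MRel I a b → (T a ↔ T b))
    (f : MvPolynomial (Fin n) k) (hI : f ∈ I) : monProj k T f ∈ I := by
  classical
  obtain ⟨S, hS, hIS⟩ := hbin
  have hSI : ∀ s ∈ S, s ∈ I := fun s hs => hIS ▸ Ideal.subset_span hs
  rw [hIS] at hI
  have key : ∀ s ∈ S, ∀ g : MvPolynomial (Fin n) k, monProj k T (g * s) ∈ I := by
    intro s hs g
    induction g using MvPolynomial.induction_on' with
    | monomial u a =>
      rw [monProj_monomial_mul T (fun b => T (u + b)) u a (fun b => Iff.rfl)]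
      apply I.mul_mem_left
      refine monProj_binomial_mem _ ?_ s (hS s hs) (hSI s hs)
      intro a b hab
      apply hT
      rw [add_comm u, add_comm u]
      exact hab.add u
    | add p q hp hq =>
      rw [add_mul, map_add]; exact I.add_mem hp hq
  induction hI using Submodule.span_induction with
  | mem x hx => simpa using key x hx 1
  | zero => simp
  | add x y _ _ hx hy => rw [map_add]; exact I.add_mem hx hy
  | smul a x hx h =>
    clear h
    induction hx using Submodule.span_induction generalizing a with
    | mem x hx => exact key x hx a
    | zero => simp
    | add x y _ _ hx hy => rw [smul_add, map_add]; exact I.add_mem (hx a) (hy a)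
    | smul b x _ h => rw [smul_smul]; exact h (a * b)

/-- Extension by zero of exponent vectors. -/
noncomputable def extE {n : ℕ} {E : Set (Fin n)} (u : ↥E →₀ ℕ) : Fin n →₀ ℕ :=
  Finsupp.mapDomain Subtype.val u

theorem extE_add {n : ℕ} {E : Set (Fin n)} (u v : ↥E →₀ ℕ) :
    extE (u + v) = extE u + extE v := Finsupp.mapDomain_add

theorem extE_zero {n : ℕ} {E : Set (Fin n)} : extE (0 : ↥E →₀ ℕ) = 0 := Finsupp.mapDomain_zero

/-- The integer vector of an exponent vector. -/
def intE {n : ℕ} {E : Set (Fin n)} (u : ↥E →₀ ℕ) : ↥E → ℤ := fun i => (u i : ℤ)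

theorem intE_add {n : ℕ} {E : Set (Fin n)} (u v : ↥E →₀ ℕ) :
    intE (u + v) = intE u + intE v := by
  ext i; simp [intE]

theorem nzd_monomial {k : Type*} [Field k] {n : ℕ} {I : Ideal (MvPolynomial (Fin n) k)}
    {E : Set (Fin n)} (hz : ∀ i ∈ E, ∀ f, X i * f ∈ I → f ∈ I) (u : ↥E →₀ ℕ) :
    ∀ (c : k), c ≠ 0 → ∀ f, monomial (extE u) c * f ∈ I → f ∈ I := by
  have h1 : ∀ f, monomial (extE u) (1 : k) * f ∈ I → f ∈ I := by
    induction u using Finsupp.induction_linear with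
    | zero => intro f hf; rw [extE_zero] at hf; simpa using hf
    | add u v hu hv =>
      intro f hf
      apply hv; apply hu
      rw [← mul_assoc, monomial_mul, ← extE_add]
      simpa using hf
    | single i m =>
      intro f hf
      have e : (monomial (extE (Finsupp.single i m)) (1 : k)) = X i.1 ^ m := by
        rw [extE, Finsupp.mapDomain_single, X_pow_eq_monomial]
      rw [e] at hf
      clear e
      induction m with
      | zero => simpa using hf
      | succ m ih =>
        apply ih
        apply hz i.1 i.2
        rw [← mul_assoc, ← pow_succ']; exact hf
  intro c hc f hf
  apply h1
  have := I.mul_mem_left (C c⁻¹) hf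
  rw [← mul_assoc, C_mul_monomial, inv_mul_cancel₀ hc] at this
  exact this

/-- The coarser relation on monomials, up to multiplication by monomials in `E`. -/
def BRel {k : Type*} [Field k] {n : ℕ} (I : Ideal (MvPolynomial (Fin n) k))
    (E : Set (Fin n)) (a b : Fin n →₀ ℕ) : Prop :=
  ∃ u v : ↥E →₀ ℕ, MRel I (a + extE u) (b + extE v)

theorem BRel.refl {k : Type*} [Field k] {n : ℕ} (I : Ideal (MvPolynomial (Fin n) k))
    (E : Set (Fin n)) (a : Fin n →₀ ℕ) : BRel I E a a := ⟨0, 0, MRel.refl _ _⟩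

theorem BRel.symm {k : Type*} [Field k] {n : ℕ} {I : Ideal (MvPolynomial (Fin n) k)}
    {E : Set (Fin n)} {a b : Fin n →₀ ℕ} (h : BRel I E a b) : BRel I E b a := by
  obtain ⟨u, v, h⟩ := h
  exact ⟨v, u, h.symm⟩

theorem BRel.trans {k : Type*} [Field k] {n : ℕ} {I : Ideal (MvPolynomial (Fin n) k)}
    {E : Set (Fin n)} {a b c : Fin n →₀ ℕ} (h : BRel I E a b) (h' : BRel I E b c) :
    BRel I E a c := by
  obtain ⟨u, v, h⟩ := h
  obtain ⟨u', v', h'⟩ := h'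
  refine ⟨u + u', v' + v, ?_⟩
  rw [extE_add, extE_add, ← add_assoc, ← add_assoc]
  refine (h.add _).trans ?_
  rw [add_right_comm]
  exact h'.add _

theorem BRel.of_mrel {k : Type*} [Field k] {n : ℕ} {I : Ideal (MvPolynomial (Fin n) k)}
    {E : Set (Fin n)} {a b : Fin n →₀ ℕ} (h : MRel I a b) : BRel I E a b :=
  ⟨0, 0, h.add _⟩

theorem BRel.add_left {k : Type*} [Field k] {n : ℕ} (I : Ideal (MvPolynomial (Fin n) k))
    {E : Set (Fin n)} (b : Fin n →₀ ℕ) (u : ↥E →₀ ℕ) : BRel I E (extE u + b) b := by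
  refine ⟨0, u, ?_⟩
  rw [extE_zero, add_zero, add_comm]
  exact MRel.refl _ _

theorem rename_mon {k : Type*} [Field k] {n : ℕ} {E : Set (Fin n)} (u : ↥E →₀ ℕ) (c : k) :
    rename (Subtype.val : ↥E → Fin n) (monomial u c) = monomial (extE u) c :=
  rename_monomial _ _ _

/-- Projection onto a coarse class commutes with multiplication by `k[E]`. -/
theorem monProj_class_mul {k : Type*} [Field k] {n : ℕ} (I : Ideal (MvPolynomial (Fin n) k))
    {E : Set (Fin n)} (a : Fin n →₀ ℕ) (g : MvPolynomial ↥E k) (f : MvPolynomial (Fin n) k) :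
    monProj k (fun b => BRel I E b a) (rename Subtype.val g * f) =
      rename Subtype.val g * monProj k (fun b => BRel I E b a) f := by
  induction g using MvPolynomial.induction_on' with
  | monomial u c =>
    rw [rename_mon]
    apply monProj_monomial_mul
    intro b
    exact ⟨fun h => (BRel.add_left I b u).symm.trans h, fun h => (BRel.add_left I b u).trans h⟩
  | add p q hp hq => rw [map_add, add_mul, map_add, hp, hq, add_mul]

/-- Reduction to a single coarse class. -/
theorem exists_class {k : Type*} [Field k] {n : ℕ} {I P : Ideal (MvPolynomial (Fin n) k)}
    (hbin : IsBinomialIdeal I) [hP : P.IsPrime] (E : Set (Fin n)) (f : MvPolynomial (Fin n) k)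
    (hf : ∀ g, g ∈ P ↔ g * f ∈ I) :
    ∃ (a : Fin n →₀ ℕ) (F : MvPolynomial (Fin n) k), F ∉ I ∧ (∀ b ∈ F.support, BRel I E b a) ∧
      ∀ g : MvPolynomial ↥E k, rename Subtype.val g ∈ P ↔ rename Subtype.val g * F ∈ I := by
  classical
  have hfwd : ∀ (a : Fin n →₀ ℕ) (g : MvPolynomial ↥E k), rename Subtype.val g ∈ P →
      rename Subtype.val g * monProj k (fun b => BRel I E b a) f ∈ I := by
    intro a g hg
    rw [← monProj_class_mul]
    apply monProj_mem hbin _ _ _ ((hf _).mp hg)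
    intro b c hbc
    exact ⟨fun h => (BRel.of_mrel hbc).symm.trans h, fun h => (BRel.of_mrel hbc).trans h⟩
  by_contra hcon
  have hex : ∀ a : Fin n →₀ ℕ, ∃ g : MvPolynomial ↥E k, rename Subtype.val g ∉ P ∧
      rename Subtype.val g * monProj k (fun b => BRel I E b a) f ∈ I := by
    intro a
    by_contra hno
    push Not at hno
    apply hcon
    refine ⟨a, monProj k (fun b => BRel I E b a) f, ?_, ?_, ?_⟩
    · have := hno 1 (by rw [map_one]; exact fun h => hP.ne_top ((Ideal.eq_top_iff_one _).mpr h))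
      simpa using this
    · intro b hb
      rw [mem_support_iff, coeff_monProj] at hb
      by_contra hb'
      simp [hb'] at hb
    · intro g
      refine ⟨hfwd a g, fun h => ?_⟩
      by_contra hg
      exact hno g hg h
  choose g hgP hgI using hex
  have hprod : rename Subtype.val (∏ a ∈ f.support, g a) ∉ P := by
    rw [map_prod]
    intro h
    obtain ⟨a, _, ha⟩ := (Ideal.IsPrime.prod_mem_iff).mp h
    exact hgP a ha
  apply hprod
  rw [hf]
  have hker : f ∈ (I.colon {rename Subtype.val (∏ a ∈ f.support, g a)} : Ideal _) := by
    let s : Setoid (Fin n →₀ ℕ) :=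
      ⟨BRel I E, BRel.refl I E, fun h => h.symm, fun h h' => h.trans h'⟩
    refine mem_of_monProj (D := Quotient s) (fun d b => Quotient.mk s b = d) (Quotient.mk s) f
      (fun b _ d => Iff.rfl) _ ?_
    intro a ha
    have e : (fun b => Quotient.mk s b = Quotient.mk s a) = fun b => BRel I E b a := by
      ext b
      exact Quotient.eq
    rw [e, Submodule.mem_colon_singleton, smul_eq_mul, mul_comm, ← Finset.mul_prod_erase _ _ ha,
      map_mul, mul_right_comm]
    exact I.mul_mem_right _ (hgI a)
  rw [Submodule.mem_colon_singleton, smul_eq_mul, mul_comm] at hker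
  exact hker

theorem class_core {k : Type*} [Field k] {n : ℕ} {I : Ideal (MvPolynomial (Fin n) k)}
    (hbin : IsBinomialIdeal I) {E : Set (Fin n)} (hz : ∀ i ∈ E, ∀ f, X i * f ∈ I → f ∈ I)
    (L : AddSubgroup (↥E → ℤ)) (hL : ∀ (m : ↥E → ℤ) (d : ℤ), d ≠ 0 → d • m ∈ L → m ∈ L)
    (F : MvPolynomial (Fin n) k) (hFI : F ∉ I) (a : Fin n →₀ ℕ)
    (hF : ∀ b ∈ F.support, BRel I E b a)
    (hLF : ∀ (u v : ↥E →₀ ℕ) (c : k), c ≠ 0 →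
      (monomial (extE u) 1 - monomial (extE v) c) * F ∈ I → intE u - intE v ∈ L)
    (h : MvPolynomial ↥E k)
    (hinj : ∀ u ∈ h.support, ∀ v ∈ h.support, intE u - intE v ∈ L → u = v)
    (hh : rename Subtype.val h * F ∈ I) : h = 0 := by
  classical
  have key : ∀ (b : Fin n →₀ ℕ) (u v : ↥E →₀ ℕ), BRel I E b a →
      MRel I (b + extE u) (b + extE v) → intE u - intE v ∈ L := by
    rintro b u v hb ⟨c, hc, hI⟩
    apply hLF u v c hc
    conv => rw [F.as_sum, Finset.mul_sum]
    refine Ideal.sum_mem _ fun b' hb' => ?_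
    obtain ⟨s, t, c', hc', hst⟩ := (hF b' hb').trans hb.symm
    suffices hs : (monomial (extE u) 1 - monomial (extE v) c) * monomial b' 1 ∈ I by
      have := I.mul_mem_right (C (coeff b' F)) hs
      rwa [mul_assoc, mul_comm (monomial b' 1), C_mul_monomial, mul_one] at this
    apply nzd_monomial hz s 1 one_ne_zero
    have e : monomial (extE s) 1 * ((monomial (extE u) 1 - monomial (extE v) c) * monomial b' 1)
      = (monomial (extE u) 1 - monomial (extE v) c) *
          (monomial (b' + extE s) 1 - monomial (b + extE t) c')
        + monomial (extE t) c' * (monomial (b + extE u) 1 - monomial (b + extE v) c) := by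
      simp only [mul_sub, sub_mul, monomial_mul, mul_one, one_mul]
      have e1 : extE s + (extE u + b') = extE u + (b' + extE s) := by abel
      have e2 : extE s + (extE v + b') = extE v + (b' + extE s) := by abel
      have e3 : extE t + (b + extE u) = extE u + (b + extE t) := by abel
      have e4 : extE t + (b + extE v) = extE v + (b + extE t) := by abel
      rw [e1, e2, e3, e4, mul_comm c' c]
      ring
    rw [e]
    exact I.add_mem (I.mul_mem_left _ hst) (I.mul_mem_left _ hI)
  let mk : (↥E → ℤ) →+ (↥E → ℤ) ⧸ L := QuotientAddGroup.mk' L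
  have hmk : ∀ x y, mk x = mk y ↔ x - y ∈ L := by
    intro x y
    rw [← sub_eq_zero, ← map_sub]
    exact QuotientAddGroup.eq_zero_iff _
  let T : ((↥E → ℤ) ⧸ L) → (Fin n →₀ ℕ) → Prop := fun d b =>
    ∃ s t : ↥E →₀ ℕ, MRel I (b + extE s) (a + extE t) ∧ mk (intE t - intE s) = d
  have Tuniq : ∀ d d' b, T d b → T d' b → d = d' := by
    rintro d d' b ⟨s, t, h1, rfl⟩ ⟨s', t', h2, rfl⟩
    rw [hmk]
    have h3 : MRel I (b + extE (s + t')) (b + extE (s' + t)) := by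
      rw [extE_add, extE_add, ← add_assoc, ← add_assoc]
      refine (h1.add _).trans ?_
      rw [add_right_comm]
      exact (h2.symm.add _)
    have := key b _ _ ⟨s, t, h1⟩ h3
    rw [intE_add, intE_add] at this
    have := L.neg_mem this
    convert this using 1
    abel
  have TRel : ∀ d b b', MRel I b b' → T d b → T d b' := by
    rintro d b b' hb ⟨s, t, h1, h2⟩
    exact ⟨s, t, (hb.symm.add _).trans h1, h2⟩
  have Tadd : ∀ d b u, T d (extE u + b) ↔ T (d - mk (intE u)) b := by
    intro d b u
    constructor
    · rintro ⟨s, t, h1, rfl⟩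
      refine ⟨s + u, t, ?_, ?_⟩
      · convert h1 using 1
        rw [extE_add]; abel
      · rw [← map_sub, intE_add]; congr 1; abel
    · rintro ⟨s, t, h1, h2⟩
      refine ⟨s, t + u, ?_, ?_⟩
      · convert h1.add (extE u) using 1
        · abel
        · rw [extE_add]; abel
      · rw [eq_sub_iff_add_eq, ← map_add] at h2
        rw [← h2, intE_add]; congr 1; abel
  have hdeg : ∀ b, ∃ d, BRel I E b a → T d b := by
    intro b
    by_cases hb : BRel I E b a
    · obtain ⟨s, t, h1⟩ := hb
      exact ⟨_, fun _ => ⟨s, t, h1, rfl⟩⟩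
    · exact ⟨0, fun h => absurd h hb⟩
  choose deg hdeg using hdeg
  have hTdeg : ∀ b ∈ F.support, ∀ d, T d b ↔ deg b = d := by
    intro b hb d
    refine ⟨fun hd => Tuniq _ _ b (hdeg b (hF b hb)) hd, ?_⟩
    rintro rfl
    exact hdeg b (hF b hb)
  have : IsAddTorsionFree ((↥E → ℤ) ⧸ L) := by
    constructor
    intro m hm x y hxy
    obtain ⟨x, rfl⟩ := QuotientAddGroup.mk'_surjective L x
    obtain ⟨y, rfl⟩ := QuotientAddGroup.mk'_surjective L y
    change m • mk x = m • mk y at hxy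
    change mk x = mk y
    rw [← map_nsmul, ← map_nsmul, hmk, ← smul_sub] at hxy
    rw [hmk]
    apply hL _ (m : ℤ) (by exact_mod_cast hm)
    simpa using hxy
  have : AddGroup.FG (↥E → ℤ) := by
    rw [← Module.Finite.iff_addGroup_fg]; infer_instance
  have : AddMonoid.FG ((↥E → ℤ) ⧸ L) := AddGroup.fg_iff_addMonoid_fg.mp inferInstance
  have : UniqueSums ((↥E → ℤ) ⧸ L) := inferInstance
  by_contra hne
  let A := h.support.image (fun u => mk (intE u))
  let B := (F.support.image deg).filter (fun d => monProj k (T d) F ∉ I)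
  have hA : A.Nonempty := (support_nonempty.mpr hne).image _
  have hB : B.Nonempty := by
    by_contra hB
    rw [Finset.not_nonempty_iff_eq_empty, Finset.filter_eq_empty_iff] at hB
    apply hFI
    refine mem_of_monProj T deg F hTdeg I ?_
    intro b hb
    have := hB (Finset.mem_image_of_mem _ hb)
    exact not_not.mp this
  obtain ⟨a0, ha0, b0, hb0, huniq⟩ := UniqueSums.uniqueAdd_of_nonempty hA hB
  obtain ⟨u0, hu0, rfl⟩ := Finset.mem_image.mp ha0
  have hb0' := (Finset.mem_filter.mp hb0).2
  apply hb0'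
  have hnotB : ∀ d, d ∉ B → monProj k (T d) F ∈ I := by
    intro d hd
    by_contra hdI
    apply hd
    refine Finset.mem_filter.mpr ⟨?_, hdI⟩
    by_contra hd'
    apply hdI
    rw [monProj_eq_zero]
    · exact I.zero_mem
    · intro b hb hTb
      exact hd' (Finset.mem_image.mpr ⟨b, hb, (hTdeg b hb d).mp hTb⟩)
  have hp := monProj_mem hbin (T (mk (intE u0) + b0))
    (fun b b' hb => ⟨TRel _ _ _ hb, TRel _ _ _ hb.symm⟩) _ hh
  rw [h.as_sum, map_sum, Finset.sum_mul, map_sum] at hp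
  have hterm : ∀ u : ↥E →₀ ℕ, monProj k (T (mk (intE u0) + b0))
      (rename Subtype.val (monomial u (coeff u h)) * F) =
      monomial (extE u) (coeff u h) * monProj k (T (mk (intE u0) + b0 - mk (intE u))) F := by
    intro u
    rw [rename_mon]
    apply monProj_monomial_mul
    intro b
    exact Tadd _ _ _
  simp only [hterm] at hp
  rw [← Finset.add_sum_erase _ _ hu0] at hp
  have hrest : ∑ u ∈ h.support.erase u0, monomial (extE u) (coeff u h) *
      monProj k (T (mk (intE u0) + b0 - mk (intE u))) F ∈ I := by
    refine Ideal.sum_mem _ fun u hu => I.mul_mem_left _ (hnotB _ fun hB' => ?_)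
    rw [Finset.mem_erase] at hu
    have := (huniq (Finset.mem_image_of_mem _ hu.2) hB' (by abel)).1
    exact hu.1 (hinj u hu.2 u0 hu0 ((hmk _ _).mp this))
  have hmain := (I.add_mem_iff_left hrest).mp hp
  rw [add_sub_cancel_left] at hmain
  exact nzd_monomial hz u0 _ (mem_support_iff.mp hu0) _ hmain

theorem isAlg_pow_mem {k K : Type*} [Field k] [IsAlgClosed k] [Field K] [Algebra k K]
    (x : K) (m : ℕ) (hm : m ≠ 0) (c : k) (h : x ^ m = algebraMap k K c) :
    ∃ y : k, algebraMap k K y = x := by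
  have hx : IsIntegral k x := by
    refine IsIntegral.of_pow (Nat.pos_of_ne_zero hm) ?_
    rw [h]; exact isIntegral_algebraMap
  have hd := IsAlgClosed.degree_eq_one_of_irreducible k (minpoly.irreducible hx)
  obtain ⟨y, hy⟩ := minpoly.mem_range_of_degree_eq_one k x hd
  exact ⟨y, hy⟩

theorem exists_character {k : Type*} [Field k] [IsAlgClosed k] {n : ℕ}
    (P : Ideal (MvPolynomial (Fin n) k)) [hP : P.IsPrime] (E : Set (Fin n))
    (hX : ∀ i ∈ E, (X i : MvPolynomial (Fin n) k) ∉ P) :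
    ∃ (L : AddSubgroup (↥E → ℤ)) (τ : L → kˣ),
      (∀ a b : L, τ (a + b) = τ a * τ b) ∧
      (∀ (m : ↥E → ℤ) (d : ℤ), d ≠ 0 → d • m ∈ L → m ∈ L) ∧
      ∀ (u v : ↥E →₀ ℕ) (c : k), c ≠ 0 →
        (monomial (extE u) 1 - monomial (extE v) c ∈ P ↔
          ∃ hm : intE u - intE v ∈ L, (τ ⟨_, hm⟩ : k) = c) := by
  classical
  let K := FractionRing (MvPolynomial (Fin n) k ⧸ P)
  let φ : MvPolynomial (Fin n) k →ₐ[k] K :=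
    (IsScalarTower.toAlgHom k (MvPolynomial (Fin n) k ⧸ P) K).comp (Ideal.Quotient.mkₐ k P)
  have hφ : ∀ f, φ f = 0 ↔ f ∈ P := by
    intro f
    change algebraMap (MvPolynomial (Fin n) k ⧸ P) K (Ideal.Quotient.mk P f) = 0 ↔ _
    rw [FaithfulSMul.algebraMap_eq_zero_iff, Ideal.Quotient.eq_zero_iff_mem]
  let x : ↥E → K := fun i => φ (X i.1)
  have hx : ∀ i, x i ≠ 0 := fun i h => hX i.1 i.2 ((hφ _).mp h)
  let χ : (↥E → ℤ) → K := fun m => ∏ i, x i ^ (m i)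
  have χ0 : χ 0 = 1 := by simp [χ]
  have χadd : ∀ a b, χ (a + b) = χ a * χ b := by
    intro a b
    simp only [χ, Pi.add_apply]
    rw [← Finset.prod_mul_distrib]
    exact Finset.prod_congr rfl fun i _ => zpow_add₀ (hx i) _ _
  have χne : ∀ a, χ a ≠ 0 := fun a => Finset.prod_ne_zero_iff.mpr fun i _ => zpow_ne_zero _ (hx i)
  have χneg : ∀ a, χ (-a) = (χ a)⁻¹ := by
    intro a
    apply eq_inv_of_mul_eq_one_left
    rw [← χadd, neg_add_cancel, χ0]
  have χsub : ∀ a b, χ (a - b) = χ a / χ b := by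
    intro a b
    rw [sub_eq_add_neg, χadd, χneg, div_eq_mul_inv]
  have χnsmul : ∀ (m : ℕ) a, χ (m • a) = χ a ^ m := by
    intro m a
    induction m with
    | zero => simp [χ0]
    | succ m ih => rw [succ_nsmul, χadd, ih, pow_succ]
  have φmon : ∀ (u : ↥E →₀ ℕ) (c : k), φ (monomial (extE u) c) = algebraMap k K c * χ (intE u) := by
    intro u c
    rw [← rename_mon, monomial_eq, map_mul, map_mul, rename_C]
    refine congrArg₂ (fun a b => a * b) (φ.commutes c) ?_
    · rw [Finsupp.prod_fintype _ _ (by simp), map_prod, map_prod]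
      refine Finset.prod_congr rfl fun i _ => ?_
      simp [x, intE]
  let L : AddSubgroup (↥E → ℤ) :=
    { carrier := {m | ∃ c : kˣ, algebraMap k K c = χ m}
      zero_mem' := ⟨1, by simp [χ0]⟩
      add_mem' := by
        rintro a b ⟨c, hc⟩ ⟨d, hd⟩
        exact ⟨c * d, by rw [χadd, ← hc, ← hd]; simp⟩
      neg_mem' := by
        rintro a ⟨c, hc⟩
        exact ⟨c⁻¹, by rw [χneg, ← hc]; simp⟩ }
  have hLdef : ∀ m, m ∈ L ↔ ∃ c : kˣ, algebraMap k K c = χ m := fun m => Iff.rfl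
  have hL : ∀ m : L, ∃ c : kˣ, algebraMap k K c = χ m := fun m => m.2
  choose τ hτ using hL
  have hinj : Function.Injective (algebraMap k K) := (algebraMap k K).injective
  have hmem : ∀ m (y : k), algebraMap k K y = χ m → m ∈ L := by
    intro m y hy
    have : y ≠ 0 := by
      rintro rfl
      exact χne m (by rw [← hy, map_zero])
    exact ⟨Units.mk0 y this, hy⟩
  refine ⟨L, τ, ?_, ?_, ?_⟩
  · intro a b
    apply Units.ext
    apply hinj
    rw [hτ, Units.val_mul, map_mul, hτ, hτ]
    exact χadd _ _
  · intro m d hd hdm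
    have hd' : d.natAbs • m ∈ L := by
      rcases Int.natAbs_eq d with h | h
      · rw [h, natCast_zsmul] at hdm; exact hdm
      · rw [h, neg_smul, natCast_zsmul] at hdm
        simpa using L.neg_mem hdm
    obtain ⟨c, hc⟩ := hd'
    rw [χnsmul] at hc
    obtain ⟨y, hy⟩ := isAlg_pow_mem (χ m) d.natAbs (by omega) (c : k) hc.symm
    exact hmem m y hy
  · intro u v c hc
    rw [← hφ, map_sub, φmon, φmon, map_one, one_mul, sub_eq_zero, ← div_eq_iff (χne _), ← χsub]
    constructor
    · intro h
      refine ⟨hmem _ c h.symm, hinj ?_⟩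
      rw [hτ]; exact h
    · rintro ⟨hm, rfl⟩
      exact (hτ ⟨_, hm⟩).symm

theorem cell_gen_eq {k : Type*} [Field k] {n : ℕ} {E : Set (Fin n)} (m : ↥E → ℤ) (c : k) :
    rename (Subtype.val : ↥E → Fin n)
      (monomF (fun i => (m i).toNat) - c • monomF (fun i => (-(m i)).toNat)) =
    monomial (extE (Finsupp.equivFunOnFinite.symm fun i => (m i).toNat)) 1 -
      monomial (extE (Finsupp.equivFunOnFinite.symm fun i => (-(m i)).toNat)) c := by
  rw [map_sub, monomF, monomF, smul_monomial, rename_mon, rename_mon, smul_eq_mul, mul_one]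

theorem intE_pos_neg {n : ℕ} {E : Set (Fin n)} (m : ↥E → ℤ) :
    intE (Finsupp.equivFunOnFinite.symm fun i => (m i).toNat) -
      intE (Finsupp.equivFunOnFinite.symm fun i => (-(m i)).toNat) = m := by
  ext i
  simp only [intE, Pi.sub_apply, Finsupp.equivFunOnFinite_symm_apply_apply]
  omega

theorem binom_mem {k : Type*} [Field k] {n : ℕ} {E : Set (Fin n)} (L : AddSubgroup (↥E → ℤ))
    (τ : L → kˣ) (u v : ↥E →₀ ℕ) (hm : intE u - intE v ∈ L) (c : k) :
    monomial (extE u) c - monomial (extE v) (c * (τ ⟨_, hm⟩ : k)) ∈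
      Ideal.map (rename (Subtype.val : ↥E → Fin n)).toRingHom (latticeIdeal L τ) := by
  have h1 : (monomF (fun i => ((intE u - intE v) i).toNat) -
      (τ ⟨_, hm⟩ : k) • monomF (fun i => (-((intE u - intE v) i)).toNat)) ∈ latticeIdeal L τ :=
    Ideal.subset_span ⟨⟨_, hm⟩, rfl⟩
  have h2 := Ideal.mem_map_of_mem (rename (Subtype.val : ↥E → Fin n)).toRingHom h1
  change rename (Subtype.val : ↥E → Fin n) _ ∈ _ at h2
  rw [cell_gen_eq] at h2
  let w : ↥E →₀ ℕ := Finsupp.equivFunOnFinite.symm fun i => min (u i) (v i)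
  have h3 := Ideal.mul_mem_left _ (monomial (extE w) c) h2
  rw [mul_sub, monomial_mul, monomial_mul, ← extE_add, ← extE_add, mul_one] at h3
  convert h3 using 4
  · congr 1
    ext i
    simp only [w, intE, Pi.sub_apply, Finsupp.add_apply,
      Finsupp.equivFunOnFinite_symm_apply_apply]
    omega
  · congr 1
    ext i
    simp only [w, intE, Pi.sub_apply, Finsupp.add_apply,
      Finsupp.equivFunOnFinite_symm_apply_apply]
    omega

theorem reduce_E {k : Type*} [Field k] {n : ℕ} (E : Set (Fin n)) (g : MvPolynomial (Fin n) k) :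
    ∃ h : MvPolynomial ↥E k, g - rename Subtype.val h ∈ MIdeal (k := k) E := by
  classical
  induction g using MvPolynomial.induction_on' with
  | monomial b c =>
    by_cases hb : ∀ i ∈ b.support, i ∈ E
    · refine ⟨monomial (b.comapDomain Subtype.val Subtype.val_injective.injOn) c, ?_⟩
      rw [rename_monomial, Finsupp.mapDomain_comapDomain _ Subtype.val_injective, sub_self]
      · exact Ideal.zero_mem _
      · intro i hi
        exact ⟨⟨i, hb i hi⟩, rfl⟩
    · push Not at hb
      obtain ⟨i, hi, hiE⟩ := hb
      refine ⟨0, ?_⟩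
      rw [map_zero, sub_zero]
      have e : monomial b c = monomial (b - Finsupp.single i 1) c * X i := by
        rw [X, monomial_mul, mul_one, tsub_add_cancel_of_le]
        rw [Finsupp.single_le_iff]
        exact Nat.one_le_iff_ne_zero.mpr (Finsupp.mem_support_iff.mp hi)
      rw [e]
      exact Ideal.mul_mem_left _ _ (Ideal.subset_span ⟨i, hiE, rfl⟩)
  | add p q hp hq =>
    obtain ⟨h, hh⟩ := hp
    obtain ⟨h', hh'⟩ := hq
    refine ⟨h + h', ?_⟩
    convert Ideal.add_mem _ hh hh' using 1
    rw [map_add]; ring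

theorem reduce_L {k : Type*} [Field k] {n : ℕ} {E : Set (Fin n)} (L : AddSubgroup (↥E → ℤ))
    (τ : L → kˣ) (h : MvPolynomial ↥E k) :
    ∃ h' : MvPolynomial ↥E k,
      (∀ u ∈ h'.support, ∀ v ∈ h'.support, intE u - intE v ∈ L → u = v) ∧
      rename Subtype.val h - rename Subtype.val h' ∈
      Ideal.map (rename (Subtype.val : ↥E → Fin n)).toRingHom (latticeIdeal L τ) := by
  classical
  let s : Setoid (↥E →₀ ℕ) :=
    ⟨fun u v => intE u - intE v ∈ L, fun u => by simp, fun {u v} h => by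
      simpa using L.neg_mem h, fun {u v w} h h' => by simpa using L.add_mem h h'⟩
  let rep : (↥E →₀ ℕ) → (↥E →₀ ℕ) := fun u => (Quotient.mk s u).out
  have hrep : ∀ u, intE u - intE (rep u) ∈ L := fun u => s.symm (Quotient.mk_out (s := s) u)
  have hrep2 : ∀ u v, intE u - intE v ∈ L → rep u = rep v := by
    intro u v huv
    have : Quotient.mk s u = Quotient.mk s v := Quotient.sound huv
    simp only [rep, this]
  suffices hs : ∃ h' : MvPolynomial ↥E k, (∀ u ∈ h'.support, rep u = u) ∧
      rename Subtype.val h - rename Subtype.val h' ∈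
      Ideal.map (rename (Subtype.val : ↥E → Fin n)).toRingHom (latticeIdeal L τ) by
    obtain ⟨h', h1, h2⟩ := hs
    refine ⟨h', fun u hu v hv huv => ?_, h2⟩
    rw [← h1 u hu, ← h1 v hv, hrep2 u v huv]
  induction h using MvPolynomial.induction_on' with
  | monomial u c =>
    refine ⟨monomial (rep u) (c * (τ ⟨_, hrep u⟩ : k)), ?_, ?_⟩
    · intro v hv
      have := support_monomial_subset hv
      rw [Finset.mem_singleton] at this
      rw [this]
      exact (hrep2 _ _ (hrep u)).symm
    · rw [rename_mon, rename_mon]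
      exact binom_mem L τ _ _ _ _
  | add p q hp hq =>
    obtain ⟨p', h1, h2⟩ := hp
    obtain ⟨q', h3, h4⟩ := hq
    refine ⟨p' + q', ?_, ?_⟩
    · intro u hu
      rcases Finset.mem_union.mp (support_add hu) with h | h
      · exact h1 u h
      · exact h3 u h
    · convert Ideal.add_mem _ h2 h4 using 1
      rw [map_add, map_add]; ring

theorem binomial_of_form {k : Type*} [Field k] {n : ℕ} (E : Set (Fin n))
    (L : AddSubgroup (↥E → ℤ)) (τ : L → kˣ) :
    IsBinomialIdeal (MIdeal E +
          Ideal.map (rename (Subtype.val : ↥E → Fin n)).toRingHom (latticeIdeal L τ)) := by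
  classical
  rw [MIdeal, latticeIdeal, Ideal.map_span, Submodule.add_eq_sup, ← Ideal.span_union]
  refine ⟨_, ?_, rfl⟩
  rintro f (⟨i, _, rfl⟩ | ⟨_, ⟨m, rfl⟩, rfl⟩)
  · unfold IsBinomial
    rw [support_X, Finset.card_singleton]; omega
  · change IsBinomial (rename (Subtype.val : ↥E → Fin n) _)
    rw [cell_gen_eq]
    unfold IsBinomial
    refine (Finset.card_le_card (support_sub _ _ _)).trans ?_
    refine (Finset.card_union_le _ _).trans ?_
    have h1 := fun (a : Fin n →₀ ℕ) (c : k) =>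
      Finset.card_le_card (support_monomial_subset (s := a) (a := c))
    simp only [Finset.card_singleton] at h1
    exact Nat.add_le_add (h1 _ _) (h1 _ _)

theorem associated_primes_of_cellular_are_cellular_with_same_cell_indices
    {k : Type*} [Field k] [IsAlgClosed k] [CharZero k] {n : ℕ}
    (I : Ideal (MvPolynomial (Fin n) k))
    (hbin : IsBinomialIdeal I) (hcell : IsCellular I)
    (E : Set (Fin n)) (hE : E = {i : Fin n | ∀ f, X i * f ∈ I → f ∈ I}) :
    ∀ P ∈ associatedPrimes (MvPolynomial (Fin n) k) (MvPolynomial (Fin n) k ⧸ I),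
      (IsBinomialIdeal P ∧ IsCellular P ∧
        {i : Fin n | ∀ f, X i * f ∈ P → f ∈ P} = E) ∧
      ∃ (L' : AddSubgroup (↥E → ℤ)) (τ : L' → kˣ),
        (∀ a b : L', τ (a + b) = τ a * τ b) ∧
        (∀ m : ↥E → ℤ, m ∈ L' ↔ ∃ d : ℤ, d ≠ 0 ∧ d • m ∈ L') ∧
        P = MIdeal E +
          Ideal.map (rename (Subtype.val : ↥E → Fin n)).toRingHom (latticeIdeal L' τ) := by
  intro P hPass
  obtain ⟨hP, x, hx⟩ := Submodule.isAssociatedPrime_iff.mp hPass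
  obtain ⟨f, rfl⟩ := Ideal.Quotient.mk_surjective x
  have hf : ∀ g, g ∈ P ↔ g * f ∈ I := by
    intro g
    rw [hx, Submodule.mem_colon_singleton, Submodule.mem_bot, ← Ideal.Quotient.eq_zero_iff_mem]
    rfl
  have hz : ∀ i ∈ E, ∀ f, X i * f ∈ I → f ∈ I := by
    intro i hi; rw [hE] at hi; exact hi
  have hfI : f ∉ I := by
    intro h
    apply hP.ne_top
    rw [Ideal.eq_top_iff_one, hf, one_mul]; exact h
  have hXE : ∀ i ∈ E, (X i : MvPolynomial (Fin n) k) ∉ P := by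
    intro i hi h
    exact hfI (hz i hi f ((hf _).mp h))
  have hXnE : ∀ i ∉ E, (X i : MvPolynomial (Fin n) k) ∈ P := by
    intro i hi
    rw [hE] at hi
    obtain ⟨m, hm⟩ := (hcell.2 i).resolve_left hi
    exact hP.mem_of_pow_mem m ((hf _).mpr (I.mul_mem_right _ hm))
  obtain ⟨L, τ, hτ, hsat, hchar⟩ := exists_character P E hXE
  obtain ⟨a, F, hFI, hFa, hFP⟩ := exists_class hbin E f hf
  have hle : MIdeal E + Ideal.map (rename (Subtype.val : ↥E → Fin n)).toRingHom
      (latticeIdeal L τ) ≤ P := by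
    rw [Submodule.add_eq_sup]
    apply sup_le
    · rw [MIdeal, Ideal.span_le]
      rintro _ ⟨i, hi, rfl⟩
      exact hXnE i hi
    · rw [latticeIdeal, Ideal.map_span, Ideal.span_le]
      rintro _ ⟨_, ⟨m, rfl⟩, rfl⟩
      change rename (Subtype.val : ↥E → Fin n) _ ∈ P
      rw [cell_gen_eq]
      refine (hchar _ _ _ (Units.ne_zero _)).mpr ?_
      rw [intE_pos_neg]
      exact ⟨m.2, rfl⟩
  have hPeq : P = MIdeal E + Ideal.map (rename (Subtype.val : ↥E → Fin n)).toRingHom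
      (latticeIdeal L τ) := by
    refine le_antisymm ?_ hle
    intro g hg
    obtain ⟨h, hh⟩ := reduce_E E g
    obtain ⟨h', hinj, hh'⟩ := reduce_L L τ h
    have hdiff : g - rename Subtype.val h' ∈ MIdeal E +
        Ideal.map (rename (Subtype.val : ↥E → Fin n)).toRingHom (latticeIdeal L τ) := by
      have := Submodule.add_mem_sup hh hh'
      rw [sub_add_sub_cancel] at this
      exact this
    have hh'P : rename Subtype.val h' ∈ P := (P.sub_mem_iff_right hg).mp (hle hdiff)
    have h0 : h' = 0 := by
      refine class_core hbin hz L hsat F hFI a hFa ?_ h' hinj ((hFP _).mp hh'P)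
      intro u v c hc hI
      have : rename Subtype.val (monomial u 1 - monomial v c : MvPolynomial ↥E k) ∈ P := by
        rw [hFP, map_sub, rename_mon, rename_mon]; exact hI
      rw [map_sub, rename_mon, rename_mon] at this
      exact ((hchar u v c hc).mp this).1
    rw [h0, map_zero, sub_zero] at hdiff
    exact hdiff
  have hnzd : ∀ i ∈ E, ∀ f, X i * f ∈ P → f ∈ P := fun i hi f h =>
    (hP.mem_or_mem h).resolve_left (hXE i hi)
  refine ⟨⟨?_, ⟨hP.ne_top, ?_⟩, ?_⟩, L, τ, hτ, ?_, hPeq⟩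
  · rw [hPeq]; exact binomial_of_form E L τ
  · intro i
    by_cases hi : i ∈ E
    · exact Or.inl (hnzd i hi)
    · exact Or.inr ⟨1, by rw [pow_one]; exact hXnE i hi⟩
  · ext i
    refine ⟨fun h => ?_, fun h => hnzd i h⟩
    by_contra hi
    apply hP.ne_top
    rw [Ideal.eq_top_iff_one]
    apply h
    rw [mul_one]
    exact hXnE i hi
  · intro m
    exact ⟨fun h => ⟨1, one_ne_zero, by rwa [one_smul]⟩, fun ⟨d, hd, h⟩ => hsat m d hd h⟩
end

section
/- Let I ⊊ k[x₁,…,xₙ] be a cellular binomial ideal with cell indices E. Then the contraction I ∩ k[E] is a lattice ideal in k[E], i.e. I ∩ k[E] = I₊(σ) for some partial character (L,σ) on ℤ^E. -/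
open MvPolynomial

lemma binomial_form {k : Type*} [Field k] {n : ℕ} (g : MvPolynomial (Fin n) k)
    (hg : IsBinomial g) : ∃ a b u v, g = monomial a u + monomial b v := by
  unfold IsBinomial at hg
  have h := g.as_sum
  have hc : g.support.card = 0 ∨ g.support.card = 1 ∨ g.support.card = 2 := by omega
  rcases hc with hc | hc | hc
  · rw [Finset.card_eq_zero] at hc
    rw [hc] at h
    exact ⟨0, 0, 0, 0, by simpa using h⟩
  · obtain ⟨a, ha⟩ := Finset.card_eq_one.1 hc
    rw [ha] at h
    exact ⟨a, a, coeff a g, 0, by simpa using h⟩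
  · obtain ⟨a, b, hab, hs⟩ := Finset.card_eq_two.1 hc
    rw [hs, Finset.sum_pair hab] at h
    exact ⟨a, b, _, _, h⟩

lemma const_mul_mem {k : Type*} [Field k] {α : Type*} {I : Ideal (MvPolynomial α k)}
    {f : MvPolynomial α k} (c : k) (hf : f ∈ I) : C c * f ∈ I := I.mul_mem_left _ hf

lemma mono_mem {k : Type*} [Field k] {α : Type*} {I : Ideal (MvPolynomial α k)}
    {a : α →₀ ℕ} {c : k} (hc : c ≠ 0) (h : monomial a c ∈ I) : monomial a (1 : k) ∈ I := by
  have := const_mul_mem c⁻¹ h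
  rwa [C_mul_monomial, inv_mul_cancel₀ hc] at this

lemma key_functional {k : Type*} [Field k] {n : ℕ} (I : Ideal (MvPolynomial (Fin n) k))
    (hbin : IsBinomialIdeal I) (a₀ : Fin n →₀ ℕ) (ha₀ : monomial a₀ (1 : k) ∉ I)
    (f : MvPolynomial (Fin n) k) (hf : f ∈ I) (hs : a₀ ∈ f.support) :
    ∃ b ∈ f.support, b ≠ a₀ ∧ ∃ c : k, c ≠ 0 ∧ monomial b 1 - monomial a₀ c ∈ I := by
  classical
  let Q : (Fin n →₀ ℕ) → k → Prop := fun b c => c ≠ 0 ∧ monomial b 1 - monomial a₀ c ∈ I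
  let d : (Fin n →₀ ℕ) → k := fun b => if h : ∃ c, Q b c then h.choose else 0
  have huniq : ∀ c : k, monomial a₀ c ∈ I → c = 0 := by
    intro c h
    by_contra hc
    exact ha₀ (mono_mem hc h)
  have hd : ∀ b c, Q b c → d b = c := by
    intro b c h
    have hex : ∃ c, Q b c := ⟨c, h⟩
    have h1 : d b = hex.choose := dif_pos hex
    have h2 : Q b (d b) := h1 ▸ hex.choose_spec
    have h3 := I.sub_mem h.2 h2.2
    have h4 : monomial a₀ (d b - c) ∈ I := by
      rw [map_sub]
      convert h3 using 1
      ring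
    exact sub_eq_zero.1 (huniq _ h4)
  have hd0 : ∀ b, (¬ ∃ c, Q b c) → d b = 0 := fun b h => dif_neg h
  -- the effect of a single monomial in the ideal
  have hmono : ∀ a u, u ≠ 0 → monomial a u ∈ I → d a = 0 := by
    intro a u hu h
    apply hd0
    rintro ⟨c, hc, hm⟩
    have h1 := I.sub_mem (mono_mem hu h) hm
    rw [sub_sub_cancel] at h1
    exact hc (huniq _ h1)
  have htrans : ∀ a b u v, u ≠ 0 → v ≠ 0 → monomial a u + monomial b v ∈ I →
      ∀ c, Q a c → Q b (-(v⁻¹ * u * c)) := by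
    intro a b u v hu hv h c hc
    refine ⟨by simp [hu, hv, hc.1], ?_⟩
    have h1 := I.sub_mem (const_mul_mem v⁻¹ h) (const_mul_mem (v⁻¹ * u) hc.2)
    convert h1 using 1
    simp only [mul_add, mul_sub, C_mul_monomial, mul_one, inv_mul_cancel₀ hv, map_neg]
    ring
  have hbi : ∀ a b u v, monomial a u + monomial b v ∈ I → u * d a + v * d b = 0 := by
    intro a b u v h
    by_cases hu : u = 0
    · by_cases hv : v = 0
      · simp [hu, hv]
      · subst hu
        rw [map_zero, zero_add] at h
        rw [hmono _ _ hv h]; simp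
    · by_cases hv : v = 0
      · subst hv
        rw [map_zero, add_zero] at h
        rw [hmono _ _ hu h]; simp
      · by_cases hq : ∃ c, Q a c
        · obtain ⟨c, hc⟩ := hq
          rw [hd _ _ hc, hd _ _ (htrans a b u v hu hv h c hc)]
          field_simp
          ring
        · have hq' : ¬ ∃ c, Q b c := by
            rintro ⟨c, hc⟩
            exact hq ⟨_, htrans b a v u hv hu (by rwa [add_comm]) c hc⟩
          rw [hd0 _ hq, hd0 _ hq']; simp
  let φ : MvPolynomial (Fin n) k →ₗ[k] k := (basisMonomials (Fin n) k).constr k d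
  have hφ : ∀ a u, φ (monomial a u) = u * d a := by
    intro a u
    have h1 : monomial a u = u • (basisMonomials (Fin n) k a) := by
      simp [smul_monomial]
    rw [h1, map_smul, smul_eq_mul]
    congr 1
    exact Module.Basis.constr_basis _ _ _ _
  have hφI : ∀ f ∈ I, φ f = 0 := by
    obtain ⟨S, hS, hIS⟩ := hbin
    have hgen : ∀ f ∈ Ideal.span S, ∀ p, φ (p * f) = 0 := by
      intro f hf
      induction hf using Submodule.span_induction with
      | mem g hg =>
        intro p
        obtain ⟨a, b, u, v, rfl⟩ := binomial_form g (hS g hg)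
        have hgI : monomial a u + monomial b v ∈ I := hIS ▸ Ideal.subset_span hg
        induction p using MvPolynomial.induction_on' with
        | monomial e w =>
          have h1 := I.mul_mem_left (monomial e w) hgI
          rw [mul_add, monomial_mul, monomial_mul] at h1 ⊢
          rw [map_add, hφ, hφ]
          exact hbi _ _ _ _ h1
        | add p q hp hq => rw [add_mul, map_add, hp, hq, add_zero]
      | zero => simp
      | add x y _ _ hx hy => intro p; rw [mul_add, map_add, hx, hy, add_zero]
      | smul r x _ hx => intro p; rw [smul_eq_mul, ← mul_assoc]; exact hx _
    intro f hf
    have := hgen f (hIS ▸ hf) 1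
    rwa [one_mul] at this
  by_contra hno
  push Not at hno
  have h1 := hφI f hf
  rw [f.as_sum, map_sum, Finset.sum_eq_single_of_mem a₀ hs] at h1
  · rw [hφ, hd a₀ 1 ⟨one_ne_zero, by simp⟩, mul_one] at h1
    exact (mem_support_iff.1 hs) h1
  · intro b hb hne
    rw [hφ, hd0, mul_zero]
    rintro ⟨c, hc, hm⟩
    exact hno b hb hne c hc hm

/-- The contraction of a cellular binomial ideal to the polynomial ring in its cell
variables is a lattice ideal. -/
theorem cellular_contraction_is_lattice_ideal
    {k : Type*} [Field k] [CharZero k] {n : ℕ}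
    (I : Ideal (MvPolynomial (Fin n) k))
    (hbin : IsBinomialIdeal I) (hcell : IsCellular I)
    (E : Set (Fin n)) (hE : E = {i : Fin n | ∀ f, X i * f ∈ I → f ∈ I}) :
    ∃ (L : AddSubgroup (↥E → ℤ)) (σ : L → kˣ),
      (∀ a b : L, σ (a + b) = σ a * σ b) ∧
      Ideal.comap (rename (Subtype.val : ↥E → Fin n)).toRingHom I = latticeIdeal L σ := by
  classical
  set J := Ideal.comap (rename (Subtype.val : ↥E → Fin n)).toRingHom I with hJ
  have memJ : ∀ f, f ∈ J ↔ rename (Subtype.val : ↥E → Fin n) f ∈ I := fun f => Iff.rfl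
  have inj : Function.Injective (Subtype.val : ↥E → Fin n) := Subtype.val_injective
  have hXJ : ∀ (i : ↥E) f, X i * f ∈ J → f ∈ J := by
    intro i f h
    rw [memJ] at h ⊢
    rw [map_mul, rename_X] at h
    have hi : (i : Fin n) ∈ {i : Fin n | ∀ f, X i * f ∈ I → f ∈ I} := hE ▸ i.2
    exact hi _ h
  have hcancel : ∀ (a : ↥E →₀ ℕ) f, monomial a (1 : k) * f ∈ J → f ∈ J := by
    intro a
    induction a using Finsupp.induction_linear with
    | zero => intro f h; simpa using h
    | add a b ha hb =>
      intro f h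
      apply hb
      apply ha
      rwa [← mul_assoc, monomial_mul, one_mul]
    | single i m =>
      intro f h
      rw [← X_pow_eq_monomial] at h
      induction m with
      | zero => simpa using h
      | succ m ih =>
        apply ih
        apply hXJ i
        rwa [← mul_assoc, ← pow_succ']
  have hJ1 : (1 : MvPolynomial ↥E k) ∉ J := by
    intro h
    rw [memJ, map_one] at h
    exact hcell.1 ((Ideal.eq_top_iff_one _).2 h)
  have hmonJ : ∀ (a : ↥E →₀ ℕ) (c : k), monomial a c ∈ J → c = 0 := by
    intro a c h
    by_contra hc
    have h1 := mono_mem hc h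
    exact hJ1 (hcancel a 1 (by simpa using h1))
  -- independence of the representation
  have hrep : ∀ (a b a' b' : ↥E →₀ ℕ) (c : k), a + b' = a' + b →
      monomial a 1 - monomial b c ∈ J → monomial a' 1 - monomial b' c ∈ J := by
    intro a b a' b' c hab h
    apply hcancel b
    have h1 := J.mul_mem_left (monomial b' (1 : k)) h
    rw [mul_sub, monomial_mul, monomial_mul, one_mul, one_mul] at h1 ⊢
    rwa [add_comm b a', ← hab, add_comm a b', add_comm b b']
  let fs : (↥E → ℕ) → (↥E →₀ ℕ) := Finsupp.equivFunOnFinite.symm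
  let P : (↥E → ℤ) → kˣ → Prop := fun m c => ∃ a b : ↥E →₀ ℕ,
    (∀ i, (a i : ℤ) - b i = m i) ∧ monomial a 1 - monomial b (c : k) ∈ J
  have hPadd : ∀ m m' c c', P m c → P m' c' → P (m + m') (c * c') := by
    rintro m m' c c' ⟨a, b, hab, h⟩ ⟨a', b', hab', h'⟩
    refine ⟨a + a', b + b', ?_, ?_⟩
    · intro i
      have := hab i
      have := hab' i
      simp only [Finsupp.add_apply, Pi.add_apply]
      push_cast
      omega
    · have h1 := J.mul_mem_left (monomial a' (1 : k)) h
      have h2 := J.mul_mem_left (monomial b (c : k)) h'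
      have h3 := J.add_mem h1 h2
      rw [mul_sub, mul_sub, monomial_mul, monomial_mul, monomial_mul, monomial_mul] at h3
      convert h3 using 1
      simp only [one_mul, mul_one, Units.val_mul, add_comm a' a, add_comm a' b]
      ring
  have hPneg : ∀ m c, P m c → P (-m) c⁻¹ := by
    rintro m c ⟨a, b, hab, h⟩
    refine ⟨b, a, ?_, ?_⟩
    · intro i
      have := hab i
      simp only [Pi.neg_apply]
      omega
    · have h1 := J.neg_mem (const_mul_mem ((c⁻¹ : kˣ) : k) h)
      convert h1 using 1
      rw [mul_sub, C_mul_monomial, C_mul_monomial, Units.inv_mul, mul_one]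
      ring
  have hPuniq : ∀ m c c', P m c → P m c' → c = c' := by
    rintro m c c' ⟨a, b, hab, h⟩ ⟨a', b', hab', h'⟩
    have h1 := hrep a b a' b' c (by
      ext i
      have := hab i
      have := hab' i
      simp only [Finsupp.add_apply]
      omega) h
    have h2 := J.sub_mem h' h1
    rw [sub_sub_sub_cancel_left, ← map_sub] at h2
    exact Units.ext (sub_eq_zero.1 (hmonJ _ _ h2))
  let L : AddSubgroup (↥E → ℤ) :=
    { carrier := {m | ∃ c, P m c}
      zero_mem' := ⟨1, 0, 0, by simp, by simp⟩
      add_mem' := by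
        rintro m m' ⟨c, h⟩ ⟨c', h'⟩
        exact ⟨_, hPadd _ _ _ _ h h'⟩
      neg_mem' := by
        rintro m ⟨c, h⟩
        exact ⟨_, hPneg _ _ h⟩ }
  have hL : ∀ m : L, ∃ c, P m c := fun m => m.2
  choose σ hσ using hL
  refine ⟨L, σ, fun a b => hPuniq _ _ _ (hσ (a + b)) (hPadd _ _ _ _ (hσ a) (hσ b)), ?_⟩
  have hsm : ∀ (b : ↥E → ℕ) (c : k), c • (monomF b : MvPolynomial ↥E k) = monomial (fs b) c := by
    intro b c
    simp only [monomF, smul_monomial, smul_eq_mul, mul_one, fs]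
  have hbinom : ∀ (a b : ↥E →₀ ℕ) (c : k), c ≠ 0 → monomial a 1 - monomial b c ∈ J →
      monomial a 1 - monomial b c ∈ latticeIdeal L σ := by
    intro a b c hc h
    have hP : P (fun i => (a i : ℤ) - b i) (Units.mk0 c hc) := ⟨a, b, fun i => rfl, h⟩
    let m : L := ⟨_, ⟨_, hP⟩⟩
    have hs : σ m = Units.mk0 c hc := hPuniq _ _ _ (hσ m) hP
    have hgen : monomF (fun i => ((m : ↥E → ℤ) i).toNat) -
      (σ m : k) • monomF (fun i => (-((m : ↥E → ℤ) i)).toNat) ∈ latticeIdeal L σ :=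
      Ideal.subset_span ⟨m, rfl⟩
    have h1 := (latticeIdeal L σ).mul_mem_left (monomial (fs fun i => min (a i) (b i)) (1 : k)) hgen
    rw [hsm, hs, Units.val_mk0, mul_sub, monomial_mul, monomF, monomial_mul, one_mul, one_mul] at h1
    convert h1 using 3
    · congr 1
      ext i
      simp only [Finsupp.add_apply, fs, Finsupp.equivFunOnFinite_symm_apply_apply, m]
      omega
    · congr 1
      ext i
      simp only [Finsupp.add_apply, fs, Finsupp.equivFunOnFinite_symm_apply_apply, m]
      omega
  apply le_antisymm
  · have hmain : ∀ N : ℕ, ∀ f : MvPolynomial ↥E k, f.support.card = N → f ∈ J →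
        f ∈ latticeIdeal L σ := by
      intro N
      induction N using Nat.strong_induction_on with
      | _ N ih =>
        intro f hN hf
        by_cases hf0 : f = 0
        · rw [hf0]; exact Ideal.zero_mem _
        obtain ⟨a, ha⟩ := support_nonempty.2 hf0
        have hsupp := support_rename_of_injective (p := f) inj
        obtain ⟨b', hb', hne, c, hc, hbc⟩ := key_functional I hbin
          (a.mapDomain (Subtype.val : ↥E → Fin n)) (by
            intro h
            rw [← rename_monomial, ← memJ] at h
            exact one_ne_zero (hmonJ _ _ h))
          (rename (Subtype.val : ↥E → Fin n) f) hf (by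
            rw [hsupp]
            exact Finset.mem_image_of_mem _ ha)
        rw [hsupp, Finset.mem_image] at hb'
        obtain ⟨b, hb, rfl⟩ := hb'
        have hne' : b ≠ a := fun h => hne (by rw [h])
        rw [← rename_monomial, ← rename_monomial, ← map_sub, ← memJ] at hbc
        have hg := hbinom b a c hc hbc
        have hdec : f = (f - C (coeff b f) * (monomial b 1 - monomial a c)) +
          C (coeff b f) * (monomial b 1 - monomial a c) := by ring
        rw [hdec]
        refine Ideal.add_mem _ (ih _ ?_ _ rfl (J.sub_mem hf (const_mul_mem _ hbc)))
          (const_mul_mem _ hg)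
        rw [← hN]
        apply Finset.card_lt_card
        rw [Finset.ssubset_iff_of_subset]
        · refine ⟨b, hb, ?_⟩
          rw [notMem_support_iff]
          simp [coeff_C_mul, coeff_monomial, hne'.symm]
        · intro e he
          by_contra hef
          have h1 : e ≠ a := fun h => hef (h ▸ ha)
          have h2 : e ≠ b := fun h => hef (h ▸ hb)
          rw [mem_support_iff] at he
          apply he
          rw [notMem_support_iff] at hef
          simp [coeff_C_mul, coeff_monomial, hef, h1.symm, h2.symm]
    exact fun f hf => hmain _ f rfl hf
  · unfold latticeIdeal
    rw [Ideal.span_le]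
    rintro f ⟨m, rfl⟩
    obtain ⟨a, b, hab, h⟩ := hσ m
    rw [hsm]
    refine hrep a b _ _ _ ?_ h
    ext i
    have := hab i
    simp only [Finsupp.add_apply, fs, Finsupp.equivFunOnFinite_symm_apply_apply]
    omega
end
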